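/- arXiv:2405.08315 — 4 statements merged into one kernel-verified Lean document; each statement's English description precedes it below -/
import Mathlib

section
/- Let X be a set of intervals, q an interval, and c a real number with q.l ≤ c ≤ q.r. Then the set q ∩ X of intervals of X overlapping q is the union of the three pairwise disjoint sets A = {x ∈ X : x.l ≤ c ≤ x.r}, B = {x ∈ X : x.r < c and q.l ≤ x.r}, and C = {x ∈ X : x.l > c and x.l ≤ q.r}. -/
structure Itv where
  l : ℝ
  r : ℝ

def Itv.overlaps (x q : Itv) : Prop := q.l ≤ x.r ∧ x.l ≤ q.r

/-- Correctness of Case 3 of the AIT algorithm: when `q.l ≤ c ≤ q.r`, the range query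
result `q ∩ X` is the union of the three pairwise disjoint sets `A`, `B`, `C`. -/
theorem stmt_8 (X : Set Itv) (q : Itv) (c : ℝ)
    (hX : ∀ x ∈ X, x.l ≤ x.r) (hq : q.l ≤ q.r)
    (h1 : q.l ≤ c) (h2 : c ≤ q.r) :
    {x ∈ X | x.overlaps q} =
      {x ∈ X | x.l ≤ c ∧ c ≤ x.r} ∪ {x ∈ X | x.r < c ∧ q.l ≤ x.r} ∪
        {x ∈ X | x.l > c ∧ x.l ≤ q.r} ∧
    Disjoint {x ∈ X | x.l ≤ c ∧ c ≤ x.r} {x ∈ X | x.r < c ∧ q.l ≤ x.r} ∧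
    Disjoint {x ∈ X | x.l ≤ c ∧ c ≤ x.r} {x ∈ X | x.l > c ∧ x.l ≤ q.r} ∧
    Disjoint {x ∈ X | x.r < c ∧ q.l ≤ x.r} {x ∈ X | x.l > c ∧ x.l ≤ q.r} := by
  refine ⟨?_, ?_, ?_, ?_⟩
  · ext x
    simp only [Set.mem_union, Set.mem_ofPred_eq, Itv.overlaps]
    constructor
    · rintro ⟨hx, hqr, hlq⟩
      rcases lt_or_ge x.r c with hr | hr
      · exact Or.inl (Or.inr ⟨hx, hr, hqr⟩)
      · rcases lt_or_ge c x.l with hl | hl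
        · exact Or.inr ⟨hx, hl, hlq⟩
        · exact Or.inl (Or.inl ⟨hx, hl, hr⟩)
    · rintro ((⟨hx, hl, hr⟩ | ⟨hx, hr, hqr⟩) | ⟨hx, hl, hlq⟩)
      · exact ⟨hx, h1.trans hr, hl.trans h2⟩
      · exact ⟨hx, hqr, (hX x hx).trans (hr.le.trans h2)⟩
      · exact ⟨hx, h1.trans (hl.le.trans (hX x hx)), hlq⟩
  · rw [Set.disjoint_left]
    rintro x ⟨-, -, hr⟩ ⟨-, hr', -⟩
    exact hr.not_gt hr'
  · rw [Set.disjoint_left]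
    rintro x ⟨-, hl, -⟩ ⟨-, hl', -⟩
    exact hl.not_gt hl'
  · rw [Set.disjoint_left]
    rintro x ⟨hx, hr, -⟩ ⟨-, hl, -⟩
    exact (hX x hx).not_gt (hr.trans hl)
end

section
/- Let X be a set of intervals, q an interval, and c a real number with q.r < c. Then q ∩ X is the union of the two disjoint sets {x ∈ X : x.l ≤ c ≤ x.r and x.l ≤ q.r} and {x ∈ X : x.r < c and x overlaps q}; in particular no interval x ∈ X with x.l > c belongs to q ∩ X. -/
/-- Correctness of Case 1 of the AIT traversal: when `q.r < c`, the range query result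
`q ∩ X` is the disjoint union of the overlapping intervals of the node's stabbing list
and the overlapping intervals of the left subtree; no interval with `x.l > c` overlaps `q`. -/
theorem stmt_9 (X : Set Itv) (q : Itv) (c : ℝ)
    (hX : ∀ x ∈ X, x.l ≤ x.r) (hq : q.l ≤ q.r)
    (h1 : q.r < c) :
    {x ∈ X | x.overlaps q} =
      {x ∈ X | (x.l ≤ c ∧ c ≤ x.r) ∧ x.l ≤ q.r} ∪ {x ∈ X | x.r < c ∧ x.overlaps q} ∧
    Disjoint {x ∈ X | (x.l ≤ c ∧ c ≤ x.r) ∧ x.l ≤ q.r} {x ∈ X | x.r < c ∧ x.overlaps q} ∧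
    ∀ x ∈ X, x.l > c → ¬ x.overlaps q := by
  refine ⟨?_, ?_, ?_⟩
  · ext x
    simp only [Set.mem_ofPred_eq, Set.mem_union, Itv.overlaps]
    constructor
    · rintro ⟨hx, hl, hr⟩
      rcases lt_or_ge x.r c with h | h
      · exact Or.inr ⟨hx, h, hl, hr⟩
      · exact Or.inl ⟨hx, ⟨hr.trans h1.le, h⟩, hr⟩
    · rintro (⟨hx, ⟨-, h⟩, hr⟩ | ⟨hx, -, h⟩)
      · exact ⟨hx, hq.trans (h1.le.trans h), hr⟩
      · exact ⟨hx, h⟩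
  · rw [Set.disjoint_left]
    rintro x ⟨-, ⟨-, h⟩, -⟩ ⟨-, h', -⟩
    exact h'.not_ge h
  · rintro x - h ⟨-, hr⟩
    exact (hr.trans_lt h1).not_gt h
end

section
/- Let L[1], ..., L[m] be intervals, each satisfying L[k].l ≤ c ≤ L[k].r for a real c, sorted in ascending order of left-endpoint (k ≤ k' implies L[k].l ≤ L[k'].l). Let q be an interval with q.r < c. Then the set of indices {k : L[k] overlaps q} equals {k : L[k].l ≤ q.r} and is an initial segment of {1, ..., m}: if k' belongs to it and k ≤ k', then k belongs to it. Consequently, if j is the largest index with L[j].l ≤ q.r, then L[k] overlaps q if and only if k ≤ j. -/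
/-- Case 1 (`q.r < c`) binary-search correctness on the left-endpoint-sorted list `L`
of a node with central point `c`: the overlapping indices are exactly those with
`(L k).l ≤ q.r`, they form an initial segment, and if `j` is the largest index with
`(L j).l ≤ q.r` then `L k` overlaps `q` iff `k ≤ j`. -/
theorem stmt_10 (m : ℕ) (L : Fin m → Itv) (c : ℝ) (q : Itv)
    (hq : q.l ≤ q.r)
    (hstab : ∀ k, (L k).l ≤ c ∧ c ≤ (L k).r)
    (hsort : ∀ k k' : Fin m, k ≤ k' → (L k).l ≤ (L k').l)
    (hc : q.r < c) :
    (∀ k, (L k).overlaps q ↔ (L k).l ≤ q.r) ∧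
    (∀ k k' : Fin m, k ≤ k' → (L k').overlaps q → (L k).overlaps q) ∧
    (∀ j : Fin m, (L j).l ≤ q.r → (∀ k, (L k).l ≤ q.r → k ≤ j) →
      ∀ k, ((L k).overlaps q ↔ k ≤ j)) := by
  have key : ∀ k, (L k).overlaps q ↔ (L k).l ≤ q.r := fun k =>
    ⟨And.right, fun h => ⟨hq.trans (hc.le.trans (hstab k).2), h⟩⟩
  refine ⟨key, fun k k' hk h => (key k).2 ((hsort k k' hk).trans h.2), fun j hj hmax k => ?_⟩
  exact ⟨fun h => hmax k h.2, fun hk => (key k).2 ((hsort k j hk).trans hj)⟩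
end

section
/- Let n ≥ 1 and let p be a probability mass function on {1, ..., n} (p_i ≥ 0, Σ p_i = 1). Then there exist probability mass functions q_1, ..., q_n on {1, ..., n}, each supported on at most two elements, such that p = (1/n) Σ_{i=1}^{n} q_i, i.e., p_j = (1/n) Σ_{i=1}^{n} q_i(j) for every j. -/
open Finset

/-- A nonnegative weight function supported on a finite set `s` with total weight `#s` is a sum of
`#s` probability mass functions, each supported on at most two elements. -/
theorem exists_sum_pmf_support_card_le_two {ι : Type*} [Fintype ι] [DecidableEq ι]
    (s : Finset ι) (w : ι → ℝ) (hw0 : ∀ i, 0 ≤ w i) (hws : ∀ i, i ∉ s → w i = 0)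
    (hw : ∑ i, w i = #s) :
    ∃ q : ι → ι → ℝ, ∀ j, w j = ∑ i ∈ s, q i j ∧
      ∀ i ∈ s, (∀ j, 0 ≤ q i j) ∧ ∑ j, q i j = 1 ∧ #{j | q i j ≠ 0} ≤ 2 := by
  induction s using Finset.strongInduction generalizing w with
  | H s ih =>
  rcases s.eq_empty_or_nonempty with rfl | hs
  · exact ⟨0, fun j => by simp [hws j]⟩
  have hsum : ∑ i ∈ s, w i = ∑ _i ∈ s, (1 : ℝ) := by
    rw [Finset.sum_subset s.subset_univ fun i _ hi => hws i hi, hw]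
    simp
  obtain ⟨a, ha, ha1⟩ := exists_le_of_sum_le hs hsum.le
  obtain ⟨b, hb, hb1⟩ := exists_le_of_sum_le hs hsum.ge
  have hab : a = b → w a = 1 := by rintro rfl; exact le_antisymm ha1 hb1
  set r : ι → ℝ := Pi.single a (w a) + Pi.single b (1 - w a) with hr
  have hr_apply (j : ι) :
      r j = (if j = a then w a else 0) + (if j = b then 1 - w a else 0) := by
    simp [hr, Pi.single_apply]
  have hr_sum : ∑ j, r j = 1 := by
    simp [hr_apply, Finset.sum_add_distrib]
  have hr0 (j : ι) : 0 ≤ r j := by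
    have := hw0 a
    rw [hr_apply]
    split_ifs <;> linarith
  have hr_card : #{j | r j ≠ 0} ≤ 2 := by
    refine (Finset.card_le_card (t := {a, b}) fun j hj => ?_).trans Finset.card_le_two
    have := hr_apply j
    grind
  have hcard : (#(s.erase a) : ℝ) = #s - 1 := by
    rw [← Finset.card_erase_add_one ha]
    simp
  obtain ⟨q, hq⟩ := ih (s.erase a) (Finset.erase_ssubset ha) (w - r)
    (fun j => by
      have := hw0 j
      have := hw0 a
      have := hr_apply j
      simp only [Pi.sub_apply]
      grind)
    (fun j hj => by
      have := hws j
      have := hr_apply j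
      simp only [Pi.sub_apply]
      grind)
    (by simp [Finset.sum_sub_distrib, hw, hr_sum, hcard])
  refine ⟨Function.update q a r, fun j => ⟨?_, fun i hi => ?_⟩⟩
  · have hq_sum : ∑ i ∈ s.erase a, Function.update q a r i j = ∑ i ∈ s.erase a, q i j :=
      Finset.sum_congr rfl fun i hi => by rw [Function.update_of_ne (Finset.ne_of_mem_erase hi)]
    rw [← Finset.add_sum_erase s _ ha, hq_sum, ← (hq j).1]
    simp
  · rcases eq_or_ne i a with rfl | hia
    · simpa only [Function.update_self] using ⟨hr0, hr_sum, hr_card⟩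
    · simpa only [Function.update_of_ne hia] using (hq j).2 i (Finset.mem_erase.2 ⟨hia, hi⟩)

/-- Structural guarantee behind Walker's alias method: any probability mass function `p`
on `{1, ..., n}` is the average of `n` probability mass functions, each supported on at
most two elements. -/
theorem stmt_15 (n : ℕ) (hn : 1 ≤ n) (p : Fin n → ℝ)
    (hp0 : ∀ i, 0 ≤ p i) (hp1 : ∑ i, p i = 1) :
    ∃ q : Fin n → Fin n → ℝ,
      (∀ i j, 0 ≤ q i j) ∧
      (∀ i, ∑ j, q i j = 1) ∧
      (∀ i, ({j | q i j ≠ 0} : Finset (Fin n)).card ≤ 2) ∧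
      (∀ j, p j = (1 / n) * ∑ i, q i j) := by
  have hn0 : (n : ℝ) ≠ 0 := by positivity
  obtain ⟨q, hq⟩ := exists_sum_pmf_support_card_le_two Finset.univ (fun i => n * p i)
    (fun i => mul_nonneg n.cast_nonneg (hp0 i)) (by simp) (by simp [← Finset.mul_sum, hp1])
  have hq' (i : Fin n) := (hq i).2 i (Finset.mem_univ i)
  refine ⟨q, fun i => (hq' i).1, fun i => (hq' i).2.1, fun i => (hq' i).2.2, fun j => ?_⟩
  rw [← (hq j).1]
  field_simp
end
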